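/- Fix q ≥ 1, θ > 0 and p ∈ Δ^{q−1}. Consider the Markov chain (𝒜_T)_{T ≥ 0} on finitely supported functions ℕ^q_* → ℕ started at the zero (empty) multiset, with the following transition from a state A with total size T = |col(A)|: for each j ∈ [q], move to A + 1_{e_j} with probability θ p_j/(θ+T), and for each 𝐚 ∈ supp A and j ∈ [q], move to A − 1_𝐚 + 1_{𝐚+e_j} with probability |𝐚| A(𝐚) p_j/(θ+T). Then for every T ≥ 1 and every A ∈ 𝒜_T, P[𝒜_T = A] = Esf_{θ,p}^T(A). -/

import Mathlib

open Finset Nat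
open scoped Classical

/-- `col(A) = ∑_𝐚 A(𝐚) • 𝐚`, the color count vector of a colored partition. -/
def colA {q : ℕ} (A : (Fin q → ℕ) →₀ ℕ) : Fin q → ℕ :=
  fun j => ∑ a ∈ A.support, A a * a j

/-- `‖A‖ = ∑_𝐚 A(𝐚)`, the number of parts of a colored partition. -/
def asize {q : ℕ} (A : (Fin q → ℕ) →₀ ℕ) : ℕ := ∑ a ∈ A.support, A a

/-- The multinomial coefficient `M_𝐧(A)` of a colored partition `A ⊨ 𝐧`. -/
noncomputable def Mcoef {q : ℕ} (n : Fin q → ℕ) (A : (Fin q → ℕ) →₀ ℕ) : ℝ :=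
  (∏ j, (n j)! : ℝ) *
    ∏ a ∈ A.support,
      ((Nat.multinomial Finset.univ a : ℝ) ^ A a / ((∑ j, a j : ℝ) ^ A a * (A a)!))

/-- The polychromatic Ewens sampling formula
`Esf_{θ,p}^n(A) = (n!/(θ)_n) θ^{‖A‖} (p^{col A}/(col A)!) M_{col A}(A)`. -/
noncomputable def esf {q : ℕ} (θ : ℝ) (p : Fin q → ℝ) (n : ℕ)
    (A : (Fin q → ℕ) →₀ ℕ) : ℝ :=
  (n ! : ℝ) / (ascPochhammer ℝ n).eval θ * θ ^ asize A *
    ((∏ j, p j ^ colA A j) / ∏ j, ((colA A j)! : ℝ)) * Mcoef (colA A) A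

/-- The `j`-th standard basis vector of `ℕ^q`. -/
def eVec {q : ℕ} (j : Fin q) : Fin q → ℕ := fun i => if i = j then 1 else 0

/-- The transition kernel of the polychromatic Hoppe urn partition process: from a state
`A` of total size `T = |col(A)|`, either a new singleton part of a random color `j` is
created (cube drawn, probability `θ p_j/(θ+T)`), or an existing part `𝐚` gains one
element of color `j` (ball drawn, probability `|𝐚| A(𝐚) p_j/(θ+T)`). -/
noncomputable def hoppeKernel {q : ℕ} (θ : ℝ) (p : Fin q → ℝ)
    (A B : (Fin q → ℕ) →₀ ℕ) : ℝ :=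
  (∑ j : Fin q, if B = A + Finsupp.single (eVec j) 1
      then θ * p j / (θ + ∑ i, colA A i) else 0) +
  ∑ a ∈ A.support, ∑ j : Fin q,
    if B = A - Finsupp.single a 1 + Finsupp.single (fun i => a i + eVec j i) 1
      then ((∑ i, a i) * A a : ℝ) * p j / (θ + ∑ i, colA A i) else 0

/-- The total size `|col(A)|` of a colored partition. -/
noncomputable def totalSize {q : ℕ} (A : (Fin q → ℕ) →₀ ℕ) : ℕ := ∑ i, colA A i

/-- The weight `θ p^𝐛 |𝐛|!/𝐛!` of a part `𝐛`, before division by its size. -/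
noncomputable def partMass {q : ℕ} (θ : ℝ) (p : Fin q → ℝ) (b : Fin q → ℕ) : ℝ :=
  θ * (∏ j, p j ^ b j) * Nat.multinomial Finset.univ b

/-- The weight `θ p^𝐛 |𝐛|!/(𝐛! |𝐛|)` of a part `𝐛`; it vanishes at `𝐛 = 0`. -/
noncomputable def partWeight {q : ℕ} (θ : ℝ) (p : Fin q → ℝ) (b : Fin q → ℕ) : ℝ :=
  partMass θ p b / ∑ j, (b j : ℝ)

/-- The unnormalized weight `∏ w(𝐚)^{A(𝐚)} / A(𝐚)!` of a colored partition. -/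
noncomputable def partitionWeight {q : ℕ} (θ : ℝ) (p : Fin q → ℝ)
    (A : (Fin q → ℕ) →₀ ℕ) : ℝ :=
  A.prod fun a n => partWeight θ p a ^ n / (n ! : ℝ)

theorem colA_add {q : ℕ} (A B : (Fin q → ℕ) →₀ ℕ) : colA (A + B) = colA A + colA B := by
  funext j
  exact Finsupp.sum_add_index' (h := fun (a : Fin q → ℕ) n => n * a j) (by simp) (by intros; ring)

theorem colA_single {q : ℕ} (a : Fin q → ℕ) : colA (Finsupp.single a 1) = a := by
  funext j
  exact (Finsupp.sum_single_index (h := fun (a : Fin q → ℕ) n => n * a j) (by simp)).trans (by simp)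

theorem totalSize_add_single {q : ℕ} (A : (Fin q → ℕ) →₀ ℕ) (a : Fin q → ℕ) :
    totalSize (A + Finsupp.single a 1) = totalSize A + ∑ i, a i := by
  simp [totalSize, colA_add, colA_single, Finset.sum_add_distrib]

theorem totalSize_eq_sum {q : ℕ} (A : (Fin q → ℕ) →₀ ℕ) :
    totalSize A = ∑ a ∈ A.support, A a * ∑ i, a i := by
  simp only [totalSize, colA, Finset.mul_sum]
  exact Finset.sum_comm

theorem sum_eVec {q : ℕ} (j : Fin q) : ∑ i, eVec j i = 1 := by
  simp [eVec]

theorem eVec_le_iff {q : ℕ} (j : Fin q) (b : Fin q → ℕ) : eVec j ≤ b ↔ 0 < b j := by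
  constructor
  · intro h
    have := h j
    simp only [eVec, if_true] at this
    omega
  · intro h i
    by_cases hi : i = j
    · subst hi
      simpa [eVec, Nat.one_le_iff_ne_zero, Nat.pos_iff_ne_zero] using h
    · simp [eVec, hi]

theorem esf_eq_partitionWeight {q : ℕ} (θ : ℝ) (p : Fin q → ℝ) (n : ℕ)
    (A : (Fin q → ℕ) →₀ ℕ) :
    esf θ p n A = (n ! : ℝ) / (ascPochhammer ℝ n).eval θ * partitionWeight θ p A := by
  have hfac : (∏ j, ((colA A j)! : ℝ)) ≠ 0 :=
    Finset.prod_ne_zero_iff.2 fun j _ => by positivity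
  have hp : ∏ j, p j ^ colA A j = ∏ a ∈ A.support, (∏ j, p j ^ a j) ^ A a := by
    simp only [colA, ← Finset.prod_pow_eq_pow_sum, ← Finset.prod_pow, ← pow_mul]
    rw [Finset.prod_comm]
    simp only [mul_comm]
  have hW : partitionWeight θ p A = θ ^ asize A * (∏ j, p j ^ colA A j) *
      ∏ a ∈ A.support,
        ((Nat.multinomial Finset.univ a : ℝ) ^ A a / ((∑ j, a j : ℝ) ^ A a * (A a)!)) := by
    rw [hp, asize, ← Finset.prod_pow_eq_pow_sum, ← Finset.prod_mul_distrib,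
      ← Finset.prod_mul_distrib]
    refine Finset.prod_congr rfl fun a _ => ?_
    simp only [partWeight, partMass, div_pow, mul_pow, div_div, mul_div_assoc]
  rw [hW, esf, Mcoef]
  field_simp

theorem partitionWeight_add_single {q : ℕ} (θ : ℝ) (p : Fin q → ℝ)
    (C : (Fin q → ℕ) →₀ ℕ) (a : Fin q → ℕ) :
    partitionWeight θ p (C + Finsupp.single a 1) * (C a + 1) =
      partWeight θ p a * partitionWeight θ p C := by
  have hC : C.support ⊆ insert a C.support := Finset.subset_insert _ _
  have hCa : (C + Finsupp.single a 1).support ⊆ insert a C.support := by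
    intro x hx
    by_cases h : x = a
    · simp [h]
    · have : C x ≠ 0 := by simpa [Finsupp.single_apply, Ne.symm h] using hx
      simp [this]
  rw [partitionWeight, partitionWeight, Finsupp.prod_of_support_subset _ hC _ (by simp),
    Finsupp.prod_of_support_subset _ hCa _ (by simp),
    ← Finset.mul_prod_erase _ _ (Finset.mem_insert_self a C.support),
    ← Finset.mul_prod_erase _ _ (Finset.mem_insert_self a C.support)]
  have hrest : ∏ x ∈ (insert a C.support).erase a,
      partWeight θ p x ^ (C + Finsupp.single a 1 : (Fin q → ℕ) →₀ ℕ) x /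
        ((C + Finsupp.single a 1 : (Fin q → ℕ) →₀ ℕ) x)! =
      ∏ x ∈ (insert a C.support).erase a, partWeight θ p x ^ C x / ((C x)! : ℝ) := by
    refine Finset.prod_congr rfl fun x hx => ?_
    simp [Ne.symm (Finset.ne_of_mem_erase hx)]
  rw [hrest]
  simp only [Finsupp.add_apply, Finsupp.single_eq_same, Nat.factorial_succ, pow_succ]
  push_cast
  field_simp

theorem multinomial_eq_sum_sub_eVec {q : ℕ} (b : Fin q → ℕ) (hb : b ≠ 0) :
    Nat.multinomial Finset.univ b =
      ∑ j, if eVec j ≤ b then Nat.multinomial Finset.univ (b - eVec j) else 0 := by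
  obtain ⟨j₀, hj₀⟩ := Function.ne_iff.1 hb
  have hpos : 0 < ∑ j, b j :=
    lt_of_lt_of_le (Nat.pos_of_ne_zero hj₀) (Finset.single_le_sum (by simp) (Finset.mem_univ j₀))
  have hterm : ∀ j, (∏ i, (b i)!) *
      (if eVec j ≤ b then Nat.multinomial Finset.univ (b - eVec j) else 0) =
      b j * (∑ i, b i - 1)! := by
    intro j
    split_ifs with h
    · obtain ⟨a, rfl⟩ : ∃ a, b = a + eVec j := ⟨b - eVec j, (tsub_add_cancel_of_le h).symm⟩
      have hfac : ∏ i, ((a + eVec j) i)! = (a j + 1) * ∏ i, (a i)! := by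
        rw [← Finset.mul_prod_erase _ _ (Finset.mem_univ j),
          ← Finset.mul_prod_erase _ (fun i => (a i)!) (Finset.mem_univ j), ← mul_assoc]
        congr 1
        · simp [eVec, Nat.factorial_succ]
        · refine Finset.prod_congr rfl fun i hi => ?_
          simp [eVec, Finset.ne_of_mem_erase hi]
      have hsum : ∑ i, (a + eVec j) i - 1 = ∑ i, a i := by
        simp [Finset.sum_add_distrib, sum_eVec]
      rw [hfac, hsum, add_tsub_cancel_right, mul_assoc, Nat.multinomial_spec]
      simp [eVec]
    · have : b j = 0 := by
        rw [eVec_le_iff] at h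
        omega
      simp [this]
  have hprod : 0 < ∏ i, (b i)! := Finset.prod_pos fun i _ => Nat.factorial_pos _
  refine Nat.eq_of_mul_eq_mul_left hprod ?_
  rw [Nat.multinomial_spec, Finset.mul_sum, Finset.sum_congr rfl fun j _ => hterm j,
    ← Finset.sum_mul, Nat.mul_factorial_pred hpos.ne']

theorem partMass_eq_sum {q : ℕ} (θ : ℝ) (p : Fin q → ℝ) (b : Fin q → ℕ) (hb : b ≠ 0) :
    partMass θ p b = ∑ j, if eVec j ≤ b then p j * partMass θ p (b - eVec j) else 0 := by
  rw [partMass, multinomial_eq_sum_sub_eVec b hb, Nat.cast_sum, Finset.mul_sum]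
  refine Finset.sum_congr rfl fun j _ => ?_
  split_ifs with h
  · obtain ⟨a, rfl⟩ : ∃ a, b = a + eVec j := ⟨b - eVec j, (tsub_add_cancel_of_le h).symm⟩
    have : ∏ i, p i ^ (a + eVec j) i = p j * ∏ i, p i ^ a i := by
      simp only [Pi.add_apply, pow_add, Finset.prod_mul_distrib]
      rw [mul_comm]
      simp [eVec]
    rw [this, add_tsub_cancel_right, partMass]
    ring
  · simp

theorem size_mul_partWeight {q : ℕ} (θ : ℝ) (p : Fin q → ℝ) (b : Fin q → ℕ) :
    (∑ j, (b j : ℝ)) * partWeight θ p b = if b = 0 then 0 else partMass θ p b := by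
  split_ifs with h
  · simp [h]
  · obtain ⟨j₀, hj₀⟩ := Function.ne_iff.1 h
    have hpos : 0 < ∑ j, b j :=
      lt_of_lt_of_le (Nat.pos_of_ne_zero hj₀)
        (Finset.single_le_sum (by simp) (Finset.mem_univ j₀))
    have : (∑ j, (b j : ℝ)) ≠ 0 := by exact_mod_cast hpos.ne'
    rw [partWeight, mul_div_cancel₀ _ this]

/-- Splitting off from a part `𝐛` the last ball it received: either `𝐛` was a new label, or
it grew from the smaller part `𝐛 - e_j`. -/
theorem size_mul_partWeight_eq_sum {q : ℕ} (θ : ℝ) (p : Fin q → ℝ) (b : Fin q → ℕ) :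
    (∑ j, (b j : ℝ)) * partWeight θ p b =
      ∑ j, ((if b = eVec j then θ * p j else 0) +
        if eVec j ≤ b then
          p j * ((∑ i, ((b - eVec j) i : ℝ)) * partWeight θ p (b - eVec j)) else 0) := by
  have he : ∀ j : Fin q, eVec j ≠ 0 := fun j h => by
    have := congrFun h j
    simp [eVec] at this
  rw [size_mul_partWeight]
  split_ifs with hb
  · subst hb
    refine (Finset.sum_eq_zero fun j _ => ?_).symm
    rw [if_neg (he j).symm, if_neg (by rw [eVec_le_iff]; simp), add_zero]
  · rw [partMass_eq_sum θ p b hb]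
    refine Finset.sum_congr rfl fun j _ => ?_
    rw [size_mul_partWeight]
    by_cases h : eVec j ≤ b
    · by_cases h' : b = eVec j
      · subst h'
        simp [partMass, mul_comm, Nat.multinomial]
      · have : b - eVec j ≠ 0 := fun h0 => h' (le_antisymm (tsub_eq_zero_iff_le.1 h0) h)
        simp [h, h', this]
    · have h' : b ≠ eVec j := fun h0 => h h0.ge
      simp [h, h']

theorem tsub_add_single {q : ℕ} {A : (Fin q → ℕ) →₀ ℕ} {a : Fin q → ℕ} (ha : a ∈ A.support) :
    A - Finsupp.single a 1 + Finsupp.single a 1 = A :=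
  tsub_add_cancel_of_le (Finsupp.single_le_iff.2 (Nat.one_le_iff_ne_zero.2 (by simpa using ha)))

/-- The kernel, reorganized as a sum over the part `𝐛` of the target that received the new
ball and over the color `j` of that ball. -/
theorem hoppeKernel_eq_sum {q : ℕ} (θ : ℝ) (p : Fin q → ℝ) (A B : (Fin q → ℕ) →₀ ℕ) :
    hoppeKernel θ p A B = ∑ b ∈ B.support, ∑ j,
      ((if A = B - Finsupp.single b 1 then
          (if b = eVec j then θ * p j else 0) / (θ + totalSize A) else 0) +
        if A = B - Finsupp.single b 1 + Finsupp.single (b - eVec j) 1 then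
          (if eVec j ≤ b then
            p j * ((∑ i, ((b - eVec j) i : ℝ)) * A (b - eVec j)) else 0) /
              (θ + totalSize A) else 0) := by
  have hT : ∑ i, colA A i = totalSize A := rfl
  simp only [hoppeKernel, hT, Finset.sum_add_distrib]
  simp only [Nat.cast_sum]
  congr 1
  · rw [Finset.sum_comm]
    refine Finset.sum_congr rfl fun j _ => ?_
    by_cases h : B = A + Finsupp.single (eVec j) 1
    · rw [if_pos h, Finset.sum_eq_single (eVec j)]
      · simp [h]
      · intro b _ hb
        simp [hb]
      · intro hb
        simp [h] at hb
    · rw [if_neg h]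
      refine (Finset.sum_eq_zero fun b hb => ?_).symm
      split_ifs with h1 h2
      · subst h2
        exact absurd (by rw [h1, tsub_add_single hb]) h
      · simp
      · rfl
  · rw [Finset.sum_comm, Finset.sum_comm (s := B.support)]
    refine Finset.sum_congr rfl fun j _ => ?_
    refine Finset.sum_bij_ne_zero (fun a _ _ => a + eVec j) ?_ ?_ ?_ ?_
    · intro a _ hne
      have h := (ite_ne_right_iff.1 hne).1
      rw [h]
      simp [Pi.add_def]
    · intro a _ _ a' _ _ h
      exact add_right_cancel h
    · intro b hb hne
      obtain ⟨hA, hne⟩ := ite_ne_right_iff.1 hne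
      have hle : eVec j ≤ b := by
        by_contra h
        simp [h] at hne
      have hb' : (fun i => (b - eVec j) i + eVec j i) = b := tsub_add_cancel_of_le hle
      have hB : B = A - Finsupp.single (b - eVec j) 1 +
          Finsupp.single (fun i => (b - eVec j) i + eVec j i) 1 := by
        rw [hb', hA, add_tsub_cancel_right, tsub_add_single hb]
      refine ⟨b - eVec j, ?_, ?_, tsub_add_cancel_of_le hle⟩
      · rw [hA]
        simp
      · rw [if_pos hB]
        rw [if_pos hle] at hne
        convert hne using 2
        ring
    · intro a ha hne
      have h := (ite_ne_right_iff.1 hne).1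
      have hA : A = B - Finsupp.single (a + eVec j) 1 +
          Finsupp.single (a + eVec j - eVec j) 1 := by
        rw [h, add_tsub_cancel_right]
        change A = A - Finsupp.single a 1 + Finsupp.single (a + eVec j) 1 - _ + _
        rw [add_tsub_cancel_right, tsub_add_single ha]
      rw [if_pos h, if_pos hA, if_pos le_add_self, add_tsub_cancel_right]
      ring

theorem finsum_mul_hoppeKernel {q : ℕ} (θ : ℝ) (p : Fin q → ℝ)
    (f : ((Fin q → ℕ) →₀ ℕ) → ℝ) (B : (Fin q → ℕ) →₀ ℕ) :
    ∑ᶠ A, f A * hoppeKernel θ p A B = ∑ b ∈ B.support, ∑ j,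
      ((if b = eVec j then θ * p j else 0) *
          (f (B - Finsupp.single b 1) / (θ + totalSize (B - Finsupp.single b 1))) +
        if eVec j ≤ b then
          p j * (∑ i, ((b - eVec j) i : ℝ)) *
            (((B - Finsupp.single b 1 : (Fin q → ℕ) →₀ ℕ) (b - eVec j) + 1) *
              (f (B - Finsupp.single b 1 + Finsupp.single (b - eVec j) 1) /
                (θ + totalSize (B - Finsupp.single b 1 + Finsupp.single (b - eVec j) 1))))
        else 0) := by
  have hfin : ∀ (g : ((Fin q → ℕ) →₀ ℕ) → ℝ) (C : (Fin q → ℕ) →₀ ℕ),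
      (Function.support fun A => f A * if A = C then g A else 0).Finite := by
    intro g C
    refine (Set.finite_singleton C).subset fun A hA => ?_
    by_contra h
    exact hA (by simp [show A ≠ C from h])
  have hfinsum : ∀ g : Fin q → ((Fin q → ℕ) →₀ ℕ) → ℝ,
      (∀ j, (Function.support (g j)).Finite) →
        (Function.support fun A => ∑ j, g j A).Finite := by
    intro g hg
    refine (Set.finite_iUnion hg).subset fun A hA => ?_
    obtain ⟨j, _, hj⟩ := Finset.exists_ne_zero_of_sum_ne_zero hA
    exact Set.mem_iUnion.2 ⟨j, hj⟩
  have hsum : ∀ (g : ((Fin q → ℕ) →₀ ℕ) → ℝ) (C : (Fin q → ℕ) →₀ ℕ),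
      (∑ᶠ A, f A * if A = C then g A else 0) = f C * g C := by
    intro g C
    rw [finsum_eq_single _ C fun A hA => by simp [hA], if_pos rfl]
  simp only [hoppeKernel_eq_sum, Finset.mul_sum, mul_add]
  rw [finsum_sum_comm]
  · refine Finset.sum_congr rfl fun b _ => ?_
    rw [finsum_sum_comm]
    · refine Finset.sum_congr rfl fun j _ => ?_
      rw [finsum_add_distrib (hfin _ _) (hfin _ _), hsum, hsum]
      congr 1
      · ring
      · split_ifs
        · simp only [Finsupp.add_apply, Finsupp.single_eq_same, ← Finset.mul_sum]
          push_cast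
          ring
        · simp
    · intro j _
      exact ((hfin _ _).union (hfin _ _)).subset (Function.support_add _ _)
  · intro b _
    exact hfinsum _ fun j =>
      ((hfin _ _).union (hfin _ _)).subset (Function.support_add _ _)

theorem hoppe_step {q : ℕ} (θ : ℝ) (hθ : 0 < θ) (p : Fin q → ℝ) (T : ℕ)
    (f : ((Fin q → ℕ) →₀ ℕ) → ℝ)
    (hf : ∀ A, f A = if totalSize A = T then esf θ p T A else 0)
    (B : (Fin q → ℕ) →₀ ℕ) :
    ∑ᶠ A, f A * hoppeKernel θ p A B =
      if totalSize B = T + 1 then esf θ p (T + 1) B else 0 := by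
  set κ : ℝ := if totalSize B = T + 1 then
    (T ! : ℝ) / (ascPochhammer ℝ T).eval θ / (θ + T) else 0 with hκ
  have hdiv : ∀ A, totalSize A + 1 = totalSize B →
      f A / (θ + totalSize A) = κ * partitionWeight θ p A := by
    intro A hA
    rw [hf, hκ, esf_eq_partitionWeight]
    by_cases h : totalSize A = T
    · rw [if_pos h, if_pos (by omega), h]
      ring
    · rw [if_neg h, if_neg (by omega)]
      simp
  have hpart : ∀ b ∈ B.support, (∑ j,
      ((if b = eVec j then θ * p j else 0) *
          (f (B - Finsupp.single b 1) / (θ + totalSize (B - Finsupp.single b 1))) +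
        if eVec j ≤ b then
          p j * (∑ i, ((b - eVec j) i : ℝ)) *
            (((B - Finsupp.single b 1 : (Fin q → ℕ) →₀ ℕ) (b - eVec j) + 1) *
              (f (B - Finsupp.single b 1 + Finsupp.single (b - eVec j) 1) /
                (θ + totalSize (B - Finsupp.single b 1 + Finsupp.single (b - eVec j) 1))))
        else 0)) = κ * partitionWeight θ p B * ((B b * ∑ i, b i : ℕ) : ℝ) := by
    intro b hb
    set C := B - Finsupp.single b 1 with hC
    have hBC : C + Finsupp.single b 1 = B := tsub_add_single hb
    have hBb : (B b : ℝ) = C b + 1 := by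
      rw [← hBC]
      simp
    have hsize : totalSize B = totalSize C + ∑ i, b i := by
      rw [← hBC, totalSize_add_single]
    have hW : partitionWeight θ p B * B b = partWeight θ p b * partitionWeight θ p C := by
      rw [hBb, ← partitionWeight_add_single, hBC]
    have hR : κ * partitionWeight θ p B * ((B b * ∑ i, b i : ℕ) : ℝ) =
        κ * partitionWeight θ p C * ((∑ i, (b i : ℝ)) * partWeight θ p b) := by
      push_cast
      linear_combination κ * (∑ i, (b i : ℝ)) * hW
    rw [hR, size_mul_partWeight_eq_sum, Finset.mul_sum]
    refine Finset.sum_congr rfl fun j _ => ?_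
    rw [mul_add]
    congr 1
    · split_ifs with h
      · rw [hdiv C (by rw [hsize, h, sum_eVec])]
        ring
      · simp
    · split_ifs with h
      · have hsum : ∑ i, b i = ∑ i, (b - eVec j) i + 1 := by
          rw [← sum_eVec j, ← Finset.sum_add_distrib]
          exact Finset.sum_congr rfl fun i _ => (tsub_add_cancel_of_le (h i)).symm
        rw [hdiv _ (by rw [hsize, totalSize_add_single, hsum, add_assoc])]
        linear_combination p j * (∑ i, ((b - eVec j) i : ℝ)) * κ *
          partitionWeight_add_single θ p C (b - eVec j)
      · simp
  rw [finsum_mul_hoppeKernel, Finset.sum_congr rfl hpart, ← Finset.mul_sum, ← Nat.cast_sum,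
    ← totalSize_eq_sum]
  by_cases h : totalSize B = T + 1
  · rw [hκ, if_pos h, if_pos h, h, esf_eq_partitionWeight, ascPochhammer_succ_eval,
      Nat.factorial_succ]
    have := ascPochhammer_pos T θ hθ
    push_cast
    field_simp
  · rw [hκ, if_neg h, if_neg h]
    simp

theorem esf_zero_eq_ite {q : ℕ} (θ : ℝ) (p : Fin q → ℝ) (A : (Fin q → ℕ) →₀ ℕ) :
    (if A = 0 then (1 : ℝ) else 0) = if totalSize A = 0 then esf θ p 0 A else 0 := by
  by_cases hA : A = 0
  · subst hA
    simp [totalSize, colA, esf_eq_partitionWeight, partitionWeight]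
  · rw [if_neg hA]
    split_ifs with h
    · obtain ⟨a, ha⟩ := Finsupp.support_nonempty_iff.2 hA
      rw [totalSize_eq_sum, Finset.sum_eq_zero_iff] at h
      have ha0 : A a ≠ 0 := by simpa using ha
      have hs : ∑ i, (a i : ℝ) = 0 := by
        exact_mod_cast (Nat.mul_eq_zero.1 (h a ha)).resolve_left ha0
      rw [esf_eq_partitionWeight, partitionWeight, Finsupp.prod,
        Finset.prod_eq_zero ha (by simp [partWeight, hs, ha0]), mul_zero]
    · rfl

/-- **Marginal distribution of the polychromatic Hoppe urn.** If `μ_T` are the marginal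
distributions of the Markov chain started at the empty partition with the Hoppe
transition kernel (i.e. `μ_0 = δ_∅` and `μ_{T+1}(B) = ∑_A μ_T(A) K(A,B)`), then for every
`T ≥ 1` and every `A ∈ 𝒜_T`, `μ_T(A) = Esf_{θ,p}^T(A)`. -/
theorem hoppe_marginal (q : ℕ) (hq : 1 ≤ q) (θ : ℝ) (hθ : 0 < θ)
    (p : Fin q → ℝ) (hp : ∀ j, 0 ≤ p j) (hp1 : ∑ j, p j = 1)
    (μ : ℕ → ((Fin q → ℕ) →₀ ℕ) → ℝ)
    (h0 : ∀ A, μ 0 A = if A = 0 then 1 else 0)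
    (hrec : ∀ T B, μ (T + 1) B = ∑ᶠ A, μ T A * hoppeKernel θ p A B) :
    ∀ T, 1 ≤ T → ∀ A : (Fin q → ℕ) →₀ ℕ, A 0 = 0 → (∑ i, colA A i) = T →
      μ T A = esf θ p T A := by
  have hμ : ∀ T A, μ T A = if totalSize A = T then esf θ p T A else 0 := by
    intro T
    induction T with
    | zero => exact fun A => (h0 A).trans (esf_zero_eq_ite θ p A)
    | succ T ih => exact fun B => (hrec T B).trans (hoppe_step θ hθ p T (μ T) ih B)
  intro T _ A _ hA
  exact (hμ T A).trans (if_pos hA)
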